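/- The Poisson center of P(sl₂(K)) equals K[C_P]: an element p ∈ P(sl₂(K)) satisfies {p, q} = 0 for all q ∈ P(sl₂(K)) if and only if p lies in the subalgebra K[C_P] of polynomials in the Casimir element C_P = 4EF + H². -/

import Mathlib

noncomputable section

variable (K : Type*) [Field K] [IsAlgClosed K] [CharZero K]

/-- A Poisson bracket on `P(sl₂(K)) = K[E,H,F]` (with `E = X 0`, `H = X 1`, `F = X 2`):
a `K`-bilinear Lie bracket satisfying the Leibniz rule with `{E,F} = H`, `{H,E} = 2E`,
`{H,F} = -2F`. -/
structure PolyPoissonBr : Type _ where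
  br : MvPolynomial (Fin 3) K → MvPolynomial (Fin 3) K → MvPolynomial (Fin 3) K
  add_left : ∀ a b c, br (a + b) c = br a c + br b c
  add_right : ∀ a b c, br a (b + c) = br a b + br a c
  smul_left : ∀ (μ : K) (a b), br (μ • a) b = μ • br a b
  smul_right : ∀ (μ : K) (a b), br a (μ • b) = μ • br a b
  alternate : ∀ a, br a a = 0
  jacobi : ∀ a b c, br a (br b c) + br b (br c a) + br c (br a b) = 0
  leibniz : ∀ a b c, br a (b * c) = b * br a c + br a b * c
  br_EF : br (MvPolynomial.X 0) (MvPolynomial.X 2) = MvPolynomial.X 1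
  br_HE : br (MvPolynomial.X 1) (MvPolynomial.X 0) = 2 * MvPolynomial.X 0
  br_HF : br (MvPolynomial.X 1) (MvPolynomial.X 2) = -2 * MvPolynomial.X 2

section Gradient

open MvPolynomial

theorem MvPolynomial.pderiv_pderiv_comm {σ R : Type*} [CommRing R] (i j : σ)
    (p : MvPolynomial σ R) : pderiv i (pderiv j p) = pderiv j (pderiv i p) := by
  classical
  have h : ⁅pderiv i, pderiv j⁆ = (0 : Derivation R (MvPolynomial σ R) (MvPolynomial σ R)) :=
    derivation_ext fun l ↦ by
      rw [Derivation.commutator_apply, pderiv_X, pderiv_X]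
      by_cases hi : l = i <;> by_cases hj : l = j <;> simp [Pi.single_apply, hi, hj, apply_ite]
  exact sub_eq_zero.mp ((Derivation.commutator_apply ..).symm.trans (DFunLike.congr_fun h p))

theorem MvPolynomial.totalDegree_pderiv_le {σ R : Type*} [CommSemiring R] (i : σ)
    (p : MvPolynomial σ R) : (pderiv i p).totalDegree ≤ p.totalDegree := by
  refine Finset.sup_le fun m hm ↦ ?_
  have hm' : m + Finsupp.single i 1 ∈ p.support := by
    rw [mem_support_iff] at hm ⊢
    rw [coeff_pderiv] at hm
    exact left_ne_zero_of_mul hm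
  refine le_trans ?_ (le_totalDegree hm')
  rw [Finsupp.sum_add_index' (fun _ ↦ rfl) (fun _ _ _ ↦ rfl)]
  exact Nat.le_add_right _ _

theorem MvPolynomial.eq_C_of_pderiv_eq_zero {σ R : Type*} [CommRing R] [IsDomain R] [CharZero R]
    {p : MvPolynomial σ R} (h : ∀ i, pderiv i p = 0) : p = C (coeff 0 p) := by
  classical
  ext m
  rw [coeff_C]
  split_ifs with hm
  · rw [hm]
  · obtain ⟨i, hi⟩ := Finsupp.ne_iff.mp (Ne.symm hm)
    have hle : Finsupp.single i 1 ≤ m := by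
      rw [Finsupp.single_le_iff]
      exact Nat.one_le_iff_ne_zero.mpr hi
    have hc := coeff_pderiv (i := i) p (m - Finsupp.single i 1)
    rw [h i, coeff_zero, tsub_add_cancel_of_le hle] at hc
    exact (mul_eq_zero.mp hc.symm).resolve_right (Nat.cast_add_one_ne_zero _)

theorem Polynomial.derivative_surjective {k : Type*} [Field k] [CharZero k] :
    Function.Surjective (Polynomial.derivative : Polynomial k →ₗ[k] Polynomial k) := by
  intro f
  induction f using Polynomial.induction_on' with
  | add p q hp hq =>
    obtain ⟨a, rfl⟩ := hp
    obtain ⟨b, rfl⟩ := hq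
    exact ⟨a + b, map_add _ _ _⟩
  | monomial n a =>
    refine ⟨Polynomial.monomial (n + 1) (a / (n + 1)), ?_⟩
    have hn : (n + 1 : k) ≠ 0 := Nat.cast_add_one_ne_zero n
    rw [Polynomial.derivative_monomial]
    simp [hn]

/-- The Casimir element `4EF + H²`. -/
abbrev casimir (k : Type*) [Field k] : MvPolynomial (Fin 3) k :=
  4 * X 0 * X 2 + X 1 ^ 2

theorem pderiv_casimir (k : Type*) [Field k] :
    pderiv 0 (casimir k) = 4 * X 2 ∧ pderiv 1 (casimir k) = 2 * X 1 ∧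
      pderiv 2 (casimir k) = 4 * X 0 := by
  have h4 (i : Fin 3) : pderiv i (4 : MvPolynomial (Fin 3) k) = 0 := (pderiv i).map_natCast 4
  refine ⟨?_, ?_, ?_⟩ <;> simp [casimir, pderiv_X, h4, mul_comm]

/-- A polynomial whose gradient is proportional to that of the Casimir element is a polynomial
in the Casimir element. -/
theorem mem_adjoin_casimir_of_pderiv {k : Type*} [Field k] [CharZero k]
    (p : MvPolynomial (Fin 3) k)
    (h0 : X 1 * pderiv 0 p = 2 * X 2 * pderiv 1 p)
    (h2 : X 1 * pderiv 2 p = 2 * X 0 * pderiv 1 p) :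
    p ∈ Algebra.adjoin k {casimir k} := by
  induction hn : p.totalDegree using Nat.strong_induction_on generalizing p with
  | _ n ih =>
  have hX : (X 1 : MvPolynomial (Fin 3) k) ≠ 0 := X_ne_zero 1
  obtain ⟨g, hg⟩ : (X 1 : MvPolynomial (Fin 3) k) ∣ pderiv 1 p := by
    have hd : (X 1 : MvPolynomial (Fin 3) k) ∣ X 0 * pderiv 1 p := by
      refine ⟨C (1 / 2) * pderiv 2 p, ?_⟩
      have hC : (C (1 / 2) * 2 : MvPolynomial (Fin 3) k) = 1 := by
        rw [← map_ofNat (C : k →+* MvPolynomial (Fin 3) k) 2, ← C_mul]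
        simp
      linear_combination (-C (1 / 2)) * h2 - X 0 * pderiv 1 p * hC
    exact (X_dvd_mul_iff.mp hd).resolve_left (by simp [X_dvd_X])
  have g2 : pderiv 2 p = 2 * X 0 * g := mul_left_cancel₀ hX (by rw [h2, hg]; ring)
  have g0 : pderiv 0 p = 2 * X 2 * g := mul_left_cancel₀ hX (by rw [h0, hg]; ring)
  have hg_mem : g ∈ Algebra.adjoin k {casimir k} := by
    by_cases hg0 : g = 0
    · rw [hg0]
      exact zero_mem _
    have two (i : Fin 3) : pderiv i (2 : MvPolynomial (Fin 3) k) = 0 := (pderiv i).map_natCast 2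
    refine ih g.totalDegree ?_ g ?_ ?_ rfl
    · have := totalDegree_pderiv_le 1 p
      rw [hg, totalDegree_mul_of_isDomain hX hg0, totalDegree_X] at this
      omega
    · have := pderiv_pderiv_comm 0 1 p
      rw [hg, g0] at this
      simpa [pderiv_mul, pderiv_X, two] using this
    · have := pderiv_pderiv_comm 2 1 p
      rw [hg, g2] at this
      simpa [pderiv_mul, pderiv_X, two] using this
  rw [Algebra.adjoin_singleton_eq_range_aeval] at hg_mem ⊢
  obtain ⟨f, hfg⟩ := hg_mem
  obtain ⟨Φ, hΦ⟩ := Polynomial.derivative_surjective ((1 / 2 : k) • f)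
  have hp : ∀ i, pderiv i (p - Polynomial.aeval (casimir k) Φ) = 0 := by
    obtain ⟨c0, c1, c2⟩ := pderiv_casimir k
    have hf : g = 2 * Polynomial.aeval (casimir k) (Polynomial.derivative Φ) := by
      change Polynomial.aeval (casimir k) f = g at hfg
      rw [hΦ, map_smul, hfg, two_mul, ← add_smul, add_halves, one_smul]
    intro i
    rw [map_sub, Derivation.map_aeval, smul_eq_mul]
    fin_cases i
    · change pderiv 0 p - _ * pderiv 0 (casimir k) = 0
      rw [g0, c0, hf]
      ring
    · change pderiv 1 p - _ * pderiv 1 (casimir k) = 0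
      rw [hg, c1, hf]
      ring
    · change pderiv 2 p - _ * pderiv 2 (casimir k) = 0
      rw [g2, c2, hf]
      ring
  refine ⟨Φ + Polynomial.C (coeff 0 (p - Polynomial.aeval (casimir k) Φ)), ?_⟩
  have := eq_C_of_pderiv_eq_zero hp
  change Polynomial.aeval (casimir k) _ = p
  rw [map_add, Polynomial.aeval_C, algebraMap_eq, ← this]
  ring

end Gradient

namespace PolyPoissonBr

open MvPolynomial

variable {k : Type*} [Field k] (B : PolyPoissonBr k)

theorem br_swap (a b : MvPolynomial (Fin 3) k) : B.br a b = -B.br b a := by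
  have h := B.alternate (a + b)
  rw [B.add_left, B.add_right, B.add_right, B.alternate, B.alternate, zero_add, add_zero] at h
  exact eq_neg_of_add_eq_zero_left h

/-- The Hamiltonian derivation `{a, −}`. -/
def ham (a : MvPolynomial (Fin 3) k) :
    Derivation k (MvPolynomial (Fin 3) k) (MvPolynomial (Fin 3) k) :=
  Derivation.mk' ⟨⟨B.br a, B.add_right a⟩, fun μ b ↦ B.smul_right μ a b⟩ fun b c ↦ by
    simp [B.leibniz, mul_comm]

theorem ham_apply (a b : MvPolynomial (Fin 3) k) : B.ham a b = B.br a b := rfl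

theorem br_eq_sum_pderiv (a p : MvPolynomial (Fin 3) k) :
    B.br a p = B.br a (X 0) * pderiv 0 p + B.br a (X 1) * pderiv 1 p
      + B.br a (X 2) * pderiv 2 p := by
  have h : B.ham a = B.br a (X 0) • pderiv 0 + B.br a (X 1) • pderiv 1
      + B.br a (X 2) • pderiv 2 := by
    refine derivation_ext fun i ↦ ?_
    fin_cases i <;> simp [ham_apply, pderiv_X]
  simpa [ham_apply] using DFunLike.congr_fun h p

theorem br_X_zero (p : MvPolynomial (Fin 3) k) :
    B.br (X 0) p = X 1 * pderiv 2 p - 2 * X 0 * pderiv 1 p := by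
  rw [B.br_eq_sum_pderiv, B.alternate, B.br_swap (X 0) (X 1), B.br_HE, B.br_EF]
  ring

theorem br_X_one (p : MvPolynomial (Fin 3) k) :
    B.br (X 1) p = 2 * X 0 * pderiv 0 p - 2 * X 2 * pderiv 2 p := by
  rw [B.br_eq_sum_pderiv, B.alternate, B.br_HE, B.br_HF]
  ring

theorem br_X_two (p : MvPolynomial (Fin 3) k) :
    B.br (X 2) p = 2 * X 2 * pderiv 1 p - X 1 * pderiv 0 p := by
  rw [B.br_eq_sum_pderiv, B.alternate, B.br_swap (X 2) (X 0), B.br_swap (X 2) (X 1), B.br_EF,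
    B.br_HF]
  ring

theorem br_casimir (q : MvPolynomial (Fin 3) k) : B.br (casimir k) q = 0 := by
  obtain ⟨c0, c1, c2⟩ := pderiv_casimir k
  rw [B.br_eq_sum_pderiv, B.br_swap _ (X 0), B.br_swap _ (X 1), B.br_swap _ (X 2), B.br_X_zero,
    B.br_X_one, B.br_X_two, c0, c1, c2]
  ring

end PolyPoissonBr

/-- The Poisson center of `P(sl₂(K))` equals `K[C_P]`: an element `p`
satisfies `{p, q} = 0` for all `q` iff `p` lies in the subalgebra generated by the Casimir
element `C_P = 4EF + H²`. -/
theorem poisson_center_eq_casimir_subalgebra (B : PolyPoissonBr K) :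
    ∀ p : MvPolynomial (Fin 3) K,
      (∀ q : MvPolynomial (Fin 3) K, B.br p q = 0) ↔
      p ∈ Algebra.adjoin K
        ({4 * MvPolynomial.X 0 * MvPolynomial.X 2 + MvPolynomial.X 1 ^ 2} :
          Set (MvPolynomial (Fin 3) K)) := by
  intro p
  constructor
  · intro h
    have hX (a : MvPolynomial (Fin 3) K) : B.br a p = 0 := by rw [B.br_swap, h, neg_zero]
    have h0 := hX (MvPolynomial.X 0)
    have h2 := hX (MvPolynomial.X 2)
    rw [B.br_X_zero] at h0
    rw [B.br_X_two] at h2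
    exact mem_adjoin_casimir_of_pderiv p (sub_eq_zero.mp h2).symm (sub_eq_zero.mp h0)
  · intro hp q
    rw [Algebra.adjoin_singleton_eq_range_aeval] at hp
    obtain ⟨f, rfl⟩ := hp
    change B.br (Polynomial.aeval (casimir K) f) q = 0
    rw [B.br_swap, ← B.ham_apply, Derivation.map_aeval, B.ham_apply, B.br_swap q, B.br_casimir,
      neg_zero, smul_zero, neg_zero]
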